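/- arXiv:2605.02692 — 3 statements merged into one kernel-verified Lean document; each statement's English description precedes it below -/
import Mathlib

section
/- For any modified deep ParaRNN N̄ with input dimension d_in, output dimension d_out, width d, block size d_s, and depth L, there exists a deep ParaRNN N with input dimension d_in, output dimension d_out, width d + d_s, block size d_s, and depth 2L such that N̄(X)[t] = N(X)[t] for every X ∈ [0,1]^{d_in×T} and every t ∈ {1,…,T}. -/
open Matrix MeasureTheory

noncomputable section

/-- The ReLU activation function. -/
def relu (x : ℝ) : ℝ := max x 0

/-- A ParaRNN recurrent layer of width `d`: recurrent weights `Wh`, input weights `Wx`,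
bias `b`, and initial hidden state `h0`. -/
structure RecLayer (d : ℕ) where
  Wh : Matrix (Fin d) (Fin d) ℝ
  Wx : Matrix (Fin d) (Fin d) ℝ
  b : Fin d → ℝ
  h0 : Fin d → ℝ

/-- The recurrent matrix is block diagonal with diagonal blocks of size `ds × ds`
(coordinates `i` and `j` interact only if they lie in the same block `⌊i/ds⌋ = ⌊j/ds⌋`). -/
def RecLayer.BlockDiag {d : ℕ} (ds : ℕ) (ℓ : RecLayer d) : Prop :=
  ∀ i j : Fin d, (i : ℕ) / ds ≠ (j : ℕ) / ds → ℓ.Wh i j = 0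

/-- Hidden states of a recurrent layer on the (0-indexed) input sequence `u`:
`state 0 = h0` and `state (t+1) = ReLU (Wh ⬝ state t + Wx ⬝ u t + b)`. -/
def RecLayer.state {d : ℕ} (ℓ : RecLayer d) (u : ℕ → Fin d → ℝ) : ℕ → Fin d → ℝ
  | 0 => ℓ.h0
  | t + 1 => fun i => relu (ℓ.Wh.mulVec (RecLayer.state ℓ u t) i + ℓ.Wx.mulVec (u t) i + ℓ.b i)

/-- The output sequence of a recurrent layer: position `t` (0-indexed) carries the hidden
state after consuming inputs `u 0, …, u t`. -/
def RecLayer.out {d : ℕ} (ℓ : RecLayer d) (u : ℕ → Fin d → ℝ) : ℕ → Fin d → ℝ :=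
  fun t => ℓ.state u (t + 1)

/-- A deep ParaRNN `N = Q ∘ F ∘ R_L ∘ ⋯ ∘ R_1 ∘ P` with input dimension `din`, output
dimension `dout`, width `d`, block size `ds`, and depth `L`. -/
structure ParaNet (din dout d ds L : ℕ) where
  P : Matrix (Fin d) (Fin din) ℝ
  layer : Fin L → RecLayer d
  blockdiag : ∀ l, (layer l).BlockDiag ds
  Wf : Matrix (Fin d) (Fin d) ℝ
  bf : Fin d → ℝ
  Q : Matrix (Fin dout) (Fin d) ℝ

/-- Sequential application of a list of recurrent layers. -/
def applyLayers {d : ℕ} (ls : List (RecLayer d)) (u : ℕ → Fin d → ℝ) : ℕ → Fin d → ℝ :=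
  ls.foldl (fun v ℓ => ℓ.out v) u

/-- The output sequence of a deep ParaRNN on a (0-indexed) input sequence: position `t`
is the paper's output `N(X)[t+1]`. -/
def ParaNet.forward {din dout d ds L : ℕ} (net : ParaNet din dout d ds L)
    (X : ℕ → Fin din → ℝ) : ℕ → Fin dout → ℝ :=
  fun t => net.Q.mulVec fun i =>
    relu ((net.Wf.mulVec
        (applyLayers (List.ofFn net.layer) (fun s => net.P.mulVec (X s)) t)) i + net.bf i)

/-- Extend a length-`T` input sequence by zero; the ParaRNN output at positions `< T` only
depends on the first `T` inputs. -/
def extendInput {din T : ℕ} (X : Fin T → Fin din → ℝ) : ℕ → Fin din → ℝ :=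
  fun t => if h : t < T then X ⟨t, h⟩ else 0

/-- `sup_{X ∈ ℝ^{din×T}, 1 ≤ t ≤ T} ‖N(X)[t]‖_∞ ≤ U`. -/
def ParaNet.Bounded {din dout d ds L : ℕ} (net : ParaNet din dout d ds L)
    (T : ℕ) (U : ℝ) : Prop :=
  ∀ (X : Fin T → Fin din → ℝ) (t : ℕ), t < T → ∀ i, |net.forward (extendInput X) t i| ≤ U

/-- The ParaRNN function class `F^{(T)}_{din,dout,d,ds,L,U}`: maps `X ↦ N(X)[T]` for deep
ParaRNNs `N` with all outputs bounded by `U` in sup norm. -/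
def ParaClass (din dout d ds L T : ℕ) (U : ℝ) :
    Set ((Fin T → Fin din → ℝ) → Fin dout → ℝ) :=
  {f | ∃ net : ParaNet din dout d ds L, net.Bounded T U ∧
        ∀ X, f X = net.forward (extendInput X) (T - 1)}

/-- The scalar-output ParaRNN class `F^{(T)}_{din,1,d,ds,L,U}`, with outputs in `ℝ`. -/
def scalarClass (din d ds L T : ℕ) (U : ℝ) : Set ((Fin T → Fin din → ℝ) → ℝ) :=
  {f | ∃ net : ParaNet din 1 d ds L, net.Bounded T U ∧
        ∀ X, f X = net.forward (extendInput X) (T - 1) 0}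

end

noncomputable section

/-- The partial activation `σ_I`: ReLU on the coordinates in `I`, identity elsewhere. -/
def actI {d : ℕ} (I : Finset (Fin d)) (v : Fin d → ℝ) : Fin d → ℝ :=
  fun i => if i ∈ I then relu (v i) else v i

/-- A modified ParaRNN recurrent layer: a ParaRNN recurrent layer whose activation is the
partial activation `σ_I` for an index set `I`. -/
structure MRecLayer (d : ℕ) extends RecLayer d where
  act : Finset (Fin d)

/-- Hidden states of a modified recurrent layer. -/
def MRecLayer.state {d : ℕ} (ℓ : MRecLayer d) (u : ℕ → Fin d → ℝ) : ℕ → Fin d → ℝ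
  | 0 => ℓ.h0
  | t + 1 => actI ℓ.act
      (fun i => ℓ.Wh.mulVec (MRecLayer.state ℓ u t) i + ℓ.Wx.mulVec (u t) i + ℓ.b i)

/-- The output sequence of a modified recurrent layer. -/
def MRecLayer.out {d : ℕ} (ℓ : MRecLayer d) (u : ℕ → Fin d → ℝ) : ℕ → Fin d → ℝ :=
  fun t => ℓ.state u (t + 1)

/-- A modified deep ParaRNN `N̄ = Q ∘ F̄ ∘ R̄_L ∘ ⋯ ∘ R̄_1 ∘ P`, where the recurrent layers
and the position-wise FC layer use partial activations `σ_I` (each with its own index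
set). -/
structure MParaNet (din dout d ds L : ℕ) where
  P : Matrix (Fin d) (Fin din) ℝ
  layer : Fin L → MRecLayer d
  blockdiag : ∀ l, (layer l).toRecLayer.BlockDiag ds
  Wf : Matrix (Fin d) (Fin d) ℝ
  bf : Fin d → ℝ
  actF : Finset (Fin d)
  Q : Matrix (Fin dout) (Fin d) ℝ

/-- Sequential application of a list of modified recurrent layers. -/
def applyMLayers {d : ℕ} (ls : List (MRecLayer d)) (u : ℕ → Fin d → ℝ) : ℕ → Fin d → ℝ :=
  ls.foldl (fun v ℓ => ℓ.out v) u

/-- The output sequence of a modified deep ParaRNN on a (0-indexed) input sequence: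
position `t` is the paper's output `N̄(X)[t+1]`. -/
def MParaNet.forward {din dout d ds L : ℕ} (net : MParaNet din dout d ds L)
    (X : ℕ → Fin din → ℝ) : ℕ → Fin dout → ℝ :=
  fun t => net.Q.mulVec (actI net.actF fun i =>
    (net.Wf.mulVec
      (applyMLayers (List.ofFn net.layer) (fun s => net.P.mulVec (X s)) t)) i + net.bf i)

end

lemma abs_relu_le (x : ℝ) : |relu x| ≤ |x| := by
  unfold relu
  rcases max_cases x 0 with ⟨h, _⟩ | ⟨h, _⟩ <;> simp [h]

lemma abs_actI_le {d : ℕ} (I : Finset (Fin d)) (v : Fin d → ℝ) (i : Fin d) :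
    |actI I v i| ≤ |v i| := by
  unfold actI
  split_ifs
  · exact abs_relu_le _
  · exact le_rfl

/-- The offset equal to `C` on the coordinates outside `I` and to `0` on `I`. -/
def actOffset {d : ℕ} (I : Finset (Fin d)) (C : ℝ) (i : Fin d) : ℝ := if i ∈ I then 0 else C

/-- On values bounded by `C`, the partial activation is ReLU conjugated by an offset. -/
lemma relu_add_actOffset {d : ℕ} (I : Finset (Fin d)) {C : ℝ} (v : Fin d → ℝ) (i : Fin d)
    (h : |v i| ≤ C) : relu (v i + actOffset I C i) = actI I v i + actOffset I C i := by
  unfold actI actOffset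
  split_ifs
  · simp
  · exact max_eq_left (by linarith [neg_abs_le (v i)])

lemma exists_abs_mulVec_le {m n : ℕ} (W : Matrix (Fin m) (Fin n) ℝ) (B : ℝ) :
    ∃ C, ∀ x : Fin n → ℝ, (∀ j, |x j| ≤ B) → ∀ i, |W.mulVec x i| ≤ C := by
  refine ⟨∑ i, ∑ j, |W i j| * |B|, fun x hx i => ?_⟩
  calc |W.mulVec x i| ≤ ∑ j, |W i j * x j| :=
        Finset.abs_sum_le_sum_abs (fun j => W i j * x j) Finset.univ
    _ ≤ ∑ j, |W i j| * |B| := by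
        refine Finset.sum_le_sum fun j _ => ?_
        rw [abs_mul]
        exact mul_le_mul_of_nonneg_left ((hx j).trans (le_abs_self B)) (abs_nonneg _)
    _ ≤ _ := Finset.single_le_sum (f := fun i => ∑ j, |W i j| * |B|)
        (fun i _ => Finset.sum_nonneg fun j _ => by positivity) (Finset.mem_univ i)

lemma exists_abs_le {d : ℕ} (b : Fin d → ℝ) : ∃ C, ∀ i, |b i| ≤ C :=
  ⟨∑ i, |b i|, fun i => Finset.single_le_sum (f := fun i => |b i|)
    (fun _ _ => abs_nonneg _) (Finset.mem_univ i)⟩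

/-- The extension of a square matrix by zero rows and columns. -/
def padMatrix {d : ℕ} (k : ℕ) (W : Matrix (Fin d) (Fin d) ℝ) :
    Matrix (Fin (d + k)) (Fin (d + k)) ℝ :=
  fun i j => Fin.append (fun i' => Fin.append (W i') (0 : Fin k → ℝ) j) (0 : Fin k → ℝ) i

lemma padMatrix_mulVec_castAdd {d k : ℕ} (W : Matrix (Fin d) (Fin d) ℝ) (x : Fin (d + k) → ℝ)
    (i : Fin d) :
    (padMatrix k W).mulVec x (Fin.castAdd k i) = W.mulVec (fun j => x (Fin.castAdd k j)) i := by
  simp [Matrix.mulVec, dotProduct, padMatrix, Fin.sum_univ_add]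

lemma padMatrix_mulVec_natAdd {d k : ℕ} (W : Matrix (Fin d) (Fin d) ℝ) (x : Fin (d + k) → ℝ)
    (i : Fin k) : (padMatrix k W).mulVec x (Fin.natAdd d i) = 0 := by
  simp [Matrix.mulVec, dotProduct, padMatrix]

/-- The pre-activation of a recurrent layer. -/
def RecLayer.pre {d : ℕ} (ℓ : RecLayer d) (h x : Fin d → ℝ) (i : Fin d) : ℝ :=
  ℓ.Wh.mulVec h i + ℓ.Wx.mulVec x i + ℓ.b i

lemma RecLayer.exists_abs_pre_le {d : ℕ} (ℓ : RecLayer d) (S B : ℝ) :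
    ∃ C, ∀ h x : Fin d → ℝ, (∀ i, |h i| ≤ S) → (∀ i, |x i| ≤ B) → ∀ i, |ℓ.pre h x i| ≤ C := by
  obtain ⟨C₁, h₁⟩ := exists_abs_mulVec_le ℓ.Wh S
  obtain ⟨C₂, h₂⟩ := exists_abs_mulVec_le ℓ.Wx B
  obtain ⟨C₃, h₃⟩ := exists_abs_le ℓ.b
  refine ⟨C₁ + C₂ + C₃, fun h x hh hx i => (abs_add_three _ _ _).trans ?_⟩
  exact add_le_add (add_le_add (h₁ h hh i) (h₂ x hx i)) (h₃ i)

lemma MRecLayer.exists_abs_state_le {d : ℕ} (m : MRecLayer d) (B : ℝ) (n : ℕ) :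
    ∃ S, ∀ u : ℕ → Fin d → ℝ, (∀ t < n, ∀ i, |u t i| ≤ B) →
      ∀ t ≤ n, ∀ i, |m.state u t i| ≤ S := by
  induction n with
  | zero =>
    obtain ⟨S, hS⟩ := exists_abs_le m.h0
    refine ⟨S, fun u _ t ht i => ?_⟩
    obtain rfl : t = 0 := by omega
    exact hS i
  | succ n ih =>
    obtain ⟨S, hS⟩ := ih
    obtain ⟨C, hC⟩ := m.toRecLayer.exists_abs_pre_le S B
    refine ⟨max S C, fun u hu t ht i => ?_⟩
    have hS' := hS u fun t ht => hu t (by omega)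
    rcases Nat.lt_or_ge n t with h | h
    · obtain rfl : t = n + 1 := by omega
      exact ((abs_actI_le _ _ i).trans
        (hC _ _ (hS' n le_rfl) (hu n (by omega)) i)).trans (le_max_right _ _)
    · exact (hS' t h i).trans (le_max_left _ _)

/-- The ReLU layer of width `d + k` simulating a modified layer whose input is offset by `c`
and whose output is offset by `c'`. -/
def MRecLayer.toOffset {d : ℕ} (k : ℕ) (m : MRecLayer d) (c c' : Fin d → ℝ) :
    RecLayer (d + k) where
  Wh := padMatrix k m.Wh
  Wx := padMatrix k m.Wx
  b := Fin.append (m.b + c' - m.Wh.mulVec c' - m.Wx.mulVec c) 0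
  h0 := Fin.append (m.h0 + c') 0

lemma MRecLayer.toOffset_blockDiag {d k ds : ℕ} {m : MRecLayer d} (c c' : Fin d → ℝ)
    (hm : m.toRecLayer.BlockDiag ds) : (m.toOffset k c c').BlockDiag ds := by
  intro i j
  induction i using Fin.addCases with
  | left i =>
    induction j using Fin.addCases with
    | left j => simpa [toOffset, padMatrix] using hm i j
    | right j => simp [toOffset, padMatrix]
  | right i => simp [toOffset, padMatrix]

/-- `v` carries `u + c` on its first `d` coordinates during the first `T` time steps. -/
def IsOffset {d k : ℕ} (T : ℕ) (c : Fin d → ℝ) (u : ℕ → Fin d → ℝ)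
    (v : ℕ → Fin (d + k) → ℝ) : Prop :=
  ∀ t < T, ∀ i, v t (Fin.castAdd k i) = u t i + c i

lemma mulVec_of_offset {d k : ℕ} (W : Matrix (Fin d) (Fin d) ℝ) {c x : Fin d → ℝ}
    {y : Fin (d + k) → ℝ} (h : ∀ i, y (Fin.castAdd k i) = x i + c i) (i : Fin d) :
    (padMatrix k W).mulVec y (Fin.castAdd k i) = W.mulVec x i + W.mulVec c i := by
  rw [padMatrix_mulVec_castAdd, funext h]
  exact congrFun (Matrix.mulVec_add W x c) i

lemma MRecLayer.exists_recLayer {d : ℕ} (k ds T : ℕ) (m : MRecLayer d)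
    (hm : m.toRecLayer.BlockDiag ds) (B : ℝ) (c : Fin d → ℝ) :
    ∃ (ℓ : RecLayer (d + k)) (B' : ℝ) (c' : Fin d → ℝ), ℓ.BlockDiag ds ∧
      ∀ u v, (∀ t < T, ∀ i, |u t i| ≤ B) → IsOffset T c u v →
        (∀ t < T, ∀ i, |m.out u t i| ≤ B') ∧ IsOffset T c' (m.out u) (ℓ.out v) := by
  obtain ⟨S, hS⟩ := m.exists_abs_state_le B T
  obtain ⟨C, hC⟩ := m.toRecLayer.exists_abs_pre_le S B
  refine ⟨m.toOffset k c (actOffset m.act C), S, actOffset m.act C,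
    m.toOffset_blockDiag _ _ hm, fun u v hu hv => ⟨fun t ht i => hS u hu (t + 1) ht i, ?_⟩⟩
  have key : ∀ t ≤ T, ∀ i, (m.toOffset k c (actOffset m.act C)).state v t (Fin.castAdd k i)
      = m.state u t i + actOffset m.act C i := by
    intro t
    induction t with
    | zero => intro _ i; simp [RecLayer.state, MRecLayer.state, toOffset]
    | succ t ih =>
      intro ht i
      refine Eq.trans ?_ (relu_add_actOffset m.act (m.toRecLayer.pre (m.state u t) (u t)) i
        (hC _ _ (hS u hu t (by omega)) (hu t ht) i))
      change relu ((padMatrix k m.Wh).mulVec _ (Fin.castAdd k i)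
        + (padMatrix k m.Wx).mulVec (v t) (Fin.castAdd k i)
        + Fin.append _ _ (Fin.castAdd k i)) = relu _
      congr 1
      rw [mulVec_of_offset m.Wh (ih (by omega)), mulVec_of_offset m.Wx (hv t ht)]
      simp only [RecLayer.pre, Fin.append_left, Pi.add_apply, Pi.sub_apply]
      ring
  exact fun t ht i => key (t + 1) ht i

lemma exists_applyLayers {d : ℕ} (k ds T : ℕ) (ms : List (MRecLayer d))
    (hms : ∀ m ∈ ms, m.toRecLayer.BlockDiag ds) (B : ℝ) (c : Fin d → ℝ) :
    ∃ (ls : List (RecLayer (d + k))) (B' : ℝ) (c' : Fin d → ℝ), ls.length = ms.length ∧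
      (∀ ℓ ∈ ls, ℓ.BlockDiag ds) ∧
      ∀ u v, (∀ t < T, ∀ i, |u t i| ≤ B) → IsOffset T c u v →
        (∀ t < T, ∀ i, |applyMLayers ms u t i| ≤ B') ∧
          IsOffset T c' (applyMLayers ms u) (applyLayers ls v) := by
  induction ms generalizing B c with
  | nil => exact ⟨[], B, c, rfl, by simp, fun u v hu hv => ⟨hu, hv⟩⟩
  | cons m ms ih =>
    obtain ⟨ℓ, B₁, c₁, hℓ, h₁⟩ := m.exists_recLayer k ds T (hms m (by simp)) B c
    obtain ⟨ls, B₂, c₂, hlen, hls, h₂⟩ := ih (fun m' h' => hms m' (by simp [h'])) B₁ c₁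
    refine ⟨ℓ :: ls, B₂, c₂, by simp [hlen], by simpa using ⟨hℓ, hls⟩, fun u v hu hv => ?_⟩
    obtain ⟨hu', hv'⟩ := h₁ u v hu hv
    exact h₂ _ _ hu' hv'

/-- The modified recurrent layer that returns its input. -/
def MRecLayer.ident (d : ℕ) : MRecLayer d where
  Wh := 0
  Wx := 1
  b := 0
  h0 := 0
  act := ∅

lemma MRecLayer.ident_out {d : ℕ} (u : ℕ → Fin d → ℝ) : (MRecLayer.ident d).out u = u := by
  funext t i
  simp [MRecLayer.out, MRecLayer.state, MRecLayer.ident, actI]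

lemma applyMLayers_append_replicate_ident {d : ℕ} (ms : List (MRecLayer d)) (n : ℕ)
    (u : ℕ → Fin d → ℝ) :
    applyMLayers (ms ++ List.replicate n (MRecLayer.ident d)) u = applyMLayers ms u := by
  unfold applyMLayers
  rw [List.foldl_append]
  induction n with
  | zero => rfl
  | succ n ih => rwa [List.replicate_succ, List.foldl_cons, MRecLayer.ident_out]

lemma exists_ofFn_eq {α : Type*} {n : ℕ} (l : List α) (h : l.length = n) :
    ∃ f : Fin n → α, List.ofFn f = l := by
  subst h
  exact ⟨l.get, List.ofFn_get l⟩

/-- A coordinate that is constantly `1` lets a linear map subtract an offset. -/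
lemma exists_mulVec_eq_sub {m d k : ℕ} (hk : 0 < k) (Q : Matrix (Fin m) (Fin d) ℝ)
    (e : Fin d → ℝ) :
    ∃ Q' : Matrix (Fin m) (Fin (d + k)) ℝ, ∀ y, (∀ j, y (Fin.natAdd d j) = 1) →
      ∀ i, Q'.mulVec y i = Q.mulVec (fun j => y (Fin.castAdd k j) - e j) i := by
  refine ⟨Matrix.of fun i => Fin.append (fun j => Q i j) (Pi.single ⟨0, hk⟩ (-∑ j, Q i j * e j)),
    fun y hy i => ?_⟩
  simp [Matrix.mulVec, dotProduct, Fin.sum_univ_add, hy, mul_add, sub_eq_add_neg,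
    Finset.sum_add_distrib]

/-- **Modified deep ParaRNNs can be represented by deep ParaRNNs.** For any modified deep
ParaRNN `N̄` with input dimension `din`, output dimension `dout`, width `d`, block size
`ds`, and depth `L`, there is a deep ParaRNN `N` with width `d + ds`, block size `ds`, and
depth `2L` such that `N̄(X)[t] = N(X)[t]` for every `X ∈ [0,1]^{din×T}` and every
`t ∈ {1,…,T}`. -/
theorem stmt17 (din dout d ds L T : ℕ)
    (hds0 : 0 < ds) (hds : Even ds) (hdvd : ds ∣ d)
    (mnet : MParaNet din dout d ds L) :
    ∃ net : ParaNet din dout (d + ds) ds (2 * L),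
      ∀ X : Fin T → Fin din → ℝ, (∀ t i, X t i ∈ Set.Icc (0 : ℝ) 1) →
        ∀ t : ℕ, t < T → ∀ i,
          mnet.forward (extendInput X) t i = net.forward (extendInput X) t i := by
  obtain ⟨B, hB⟩ := exists_abs_mulVec_le mnet.P 1
  obtain ⟨ls, B', c, hlen, hls, hsim⟩ := exists_applyLayers ds ds T
    (List.ofFn mnet.layer ++ List.replicate L (MRecLayer.ident d)) (by
      intro m hm
      rcases List.mem_append.1 hm with h | h
      · obtain ⟨l, rfl⟩ := (List.mem_ofFn' _ _).1 h
        exact mnet.blockdiag l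
      · rw [List.eq_of_mem_replicate h]
        exact fun _ _ _ => rfl) B 0
  obtain ⟨f, rfl⟩ := exists_ofFn_eq (n := 2 * L) ls (by simp [hlen]; ring)
  obtain ⟨C₁, hC₁⟩ := exists_abs_mulVec_le mnet.Wf B'
  obtain ⟨C₂, hC₂⟩ := exists_abs_le mnet.bf
  obtain ⟨P', hP⟩ : ∃ P' : Matrix (Fin (d + ds)) (Fin din) ℝ,
      ∀ x i, P'.mulVec x (Fin.castAdd ds i) = mnet.P.mulVec x i :=
    ⟨fun i j => Fin.append (fun i' => mnet.P i' j) (0 : Fin ds → ℝ) i,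
      fun x i => by simp [Matrix.mulVec, dotProduct]⟩
  let e := actOffset mnet.actF (C₁ + C₂)
  obtain ⟨Q', hQ⟩ := exists_mulVec_eq_sub hds0 mnet.Q e
  refine ⟨{
    P := P'
    layer := f
    blockdiag := fun l => hls _ ((List.mem_ofFn' _ _).2 ⟨l, rfl⟩)
    Wf := padMatrix ds mnet.Wf
    bf := Fin.append (mnet.bf + e - mnet.Wf.mulVec c) 1
    Q := Q' },
    fun X hX t ht i => ?_⟩
  obtain ⟨hb, ho⟩ := hsim (fun s => mnet.P.mulVec (extendInput X s))
    (fun s => P'.mulVec (extendInput X s))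
    (fun s hs => hB _ fun j => by
      have := hX ⟨s, hs⟩ j
      simp only [extendInput, hs, dif_pos]
      rw [abs_of_nonneg this.1]
      exact this.2)
    (fun s _ i => by simp [hP])
  rw [applyMLayers_append_replicate_ident] at hb ho
  have hF : ∀ i, relu ((padMatrix ds mnet.Wf).mulVec (applyLayers (List.ofFn f)
        (fun s => P'.mulVec (extendInput X s)) t)
        (Fin.castAdd ds i) + (mnet.bf + e - mnet.Wf.mulVec c) i)
      = actI mnet.actF (fun i => mnet.Wf.mulVec (applyMLayers (List.ofFn mnet.layer)
          (fun s => mnet.P.mulVec (extendInput X s)) t) i + mnet.bf i) i + e i := by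
    intro i
    rw [← relu_add_actOffset mnet.actF _ i
      ((abs_add_le _ _).trans (add_le_add (hC₁ _ (hb t ht) i) (hC₂ i))),
      mulVec_of_offset mnet.Wf (ho t ht)]
    congr 1
    simp only [Pi.add_apply, Pi.sub_apply, e]
    ring
  simp only [MParaNet.forward, ParaNet.forward]
  rw [hQ _ fun j => by simp [padMatrix_mulVec_natAdd, relu]]
  simp only [Fin.append_left, hF, add_sub_cancel_right]
end

section
/- Let t_0 ∈ {1,…,T} and let d_s be an even positive integer dividing (d_in + 1)d. For any feedforward ReLU network Ñ ∈ FNN_{d_in·t_0, d_out}(d, L), there exists a modified deep ParaRNN N̄ with input dimension d_in, output dimension d_out, width (d_in + 1)d, block size d_s, and depth T + L − 1 such that Ñ(x_1,…,x_{t_0}) = N̄(X)[t_0] for every X = (x_1,…,x_T) ∈ ℝ^{d_in×T}, where the FNN input is the vectorization of the first t_0 columns of X. -/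
open Matrix MeasureTheory

noncomputable section

/-- The hidden layers of a ReLU feedforward network: `fnnSeq … l` is the output of the
`l`-th hidden (ReLU) layer. -/
def fnnSeq (dims : ℕ → ℕ) (A : ∀ l : ℕ, Matrix (Fin (dims (l + 1))) (Fin (dims l)) ℝ)
    (c : ∀ l : ℕ, Fin (dims (l + 1)) → ℝ) (x : Fin (dims 0) → ℝ) :
    ∀ l : ℕ, Fin (dims l) → ℝ
  | 0 => x
  | l + 1 => fun i => relu ((A l).mulVec (fnnSeq dims A c x l) i + c l i)

/-- The output of a depth-`L` feedforward network: `L − 1` ReLU layers followed by an affine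
layer. -/
def fnnOut (dims : ℕ → ℕ) (A : ∀ l : ℕ, Matrix (Fin (dims (l + 1))) (Fin (dims l)) ℝ)
    (c : ∀ l : ℕ, Fin (dims (l + 1)) → ℝ) (L : ℕ) (x : Fin (dims 0) → ℝ) :
    Fin (dims L) → ℝ :=
  match L with
  | 0 => x
  | l + 1 => fun i => (A l).mulVec (fnnSeq dims A c x l) i + c l i

/-- Membership in `FNN_{p,q}(dmax, L)`: `g` is realized by a ReLU feedforward network of
depth `L` whose layer widths are all at most `dmax`. -/
def MemFNN (p q dmax L : ℕ) (g : (Fin p → ℝ) → Fin q → ℝ) : Prop :=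
  ∃ (dims : ℕ → ℕ) (h0 : dims 0 = p) (hL : dims L = q)
    (A : ∀ l : ℕ, Matrix (Fin (dims (l + 1))) (Fin (dims l)) ℝ)
    (c : ∀ l : ℕ, Fin (dims (l + 1)) → ℝ),
    (∀ l ≤ L, dims l ≤ dmax) ∧
    ∀ (x : Fin p → ℝ) (i : Fin q),
      g x i = fnnOut dims A c L (fun j => x (Fin.cast h0 j)) (Fin.cast hL.symm i)

/-- Vectorization (column stacking) of the first `t0` columns of `X ∈ ℝ^{din×T}`. -/
def vecCols {din T : ℕ} (t0 : ℕ) (ht : t0 ≤ T) (X : Fin T → Fin din → ℝ) :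
    Fin (din * t0) → ℝ :=
  fun j => X
    ⟨(j : ℕ) / din, by
      have h1 := j.isLt
      have hd : 0 < din := by
        rcases Nat.eq_zero_or_pos din with h | h
        · subst h; simp at h1
        · exact h
      exact lt_of_lt_of_le
        ((Nat.div_lt_iff_lt_mul hd).2 (lt_of_lt_of_le h1 (le_of_eq (Nat.mul_comm din t0)))) ht⟩
    ⟨(j : ℕ) % din, by
      have h1 := j.isLt
      have hd : 0 < din := by
        rcases Nat.eq_zero_or_pos din with h | h
        · subst h; simp at h1
        · exact h
      exact Nat.mod_lt _ hd⟩

end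

noncomputable section

/-- The modified recurrent layer without recurrence, acting position-wise as
`x ↦ σ_I(W x + b)`. -/
def MRecLayer.pointwise {d : ℕ} (W : Matrix (Fin d) (Fin d) ℝ) (b : Fin d → ℝ)
    (I : Finset (Fin d)) : MRecLayer d where
  Wh := 0
  Wx := W
  b := b
  h0 := 0
  act := I

/-- The linear recurrent layer `h_t = diag(lam) h_{t-1} + u_t` with zero initial state. -/
def MRecLayer.diagonal {d : ℕ} (lam : Fin d → ℝ) : MRecLayer d where
  Wh := Matrix.diagonal lam
  Wx := 1
  b := 0
  h0 := 0
  act := ∅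

/-- The matrix selecting the coordinates listed by `e`. -/
def selectMatrix {m n : ℕ} (e : Fin m → Fin n) : Matrix (Fin m) (Fin n) ℝ :=
  (1 : Matrix (Fin n) (Fin n) ℝ).submatrix e id

end

theorem MRecLayer.pointwise_out {d : ℕ} (W : Matrix (Fin d) (Fin d) ℝ) (b : Fin d → ℝ)
    (I : Finset (Fin d)) (u : ℕ → Fin d → ℝ) (t : ℕ) :
    (MRecLayer.pointwise W b I).out u t = actI I (W *ᵥ u t + b) := by
  simp only [MRecLayer.out, MRecLayer.state, MRecLayer.pointwise, zero_mulVec, Pi.zero_apply,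
    zero_add]
  rfl

theorem MRecLayer.pointwise_blockDiag {d : ℕ} (ds : ℕ) (W : Matrix (Fin d) (Fin d) ℝ)
    (b : Fin d → ℝ) (I : Finset (Fin d)) :
    (MRecLayer.pointwise W b I).toRecLayer.BlockDiag ds :=
  fun _ _ _ => rfl

theorem MRecLayer.diagonal_blockDiag {d : ℕ} (ds : ℕ) (lam : Fin d → ℝ) :
    (MRecLayer.diagonal lam).toRecLayer.BlockDiag ds := by
  intro i j hij
  exact Matrix.diagonal_apply_ne _ fun h => hij (by rw [h])

theorem MRecLayer.diagonal_state {d : ℕ} (lam : Fin d → ℝ) (u : ℕ → Fin d → ℝ) (t : ℕ)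
    (i : Fin d) :
    (MRecLayer.diagonal lam).state u t i =
      ∑ k ∈ Finset.range t, lam i ^ k * u (t - 1 - k) i := by
  induction t with
  | zero => rfl
  | succ t ih =>
    have step : (MRecLayer.diagonal lam).state u (t + 1) i =
        lam i * (MRecLayer.diagonal lam).state u t i + u t i := by
      simp [MRecLayer.state, MRecLayer.diagonal, actI, mulVec_diagonal]
    rw [step, ih, Finset.sum_range_succ', Finset.mul_sum]
    congr 1
    · refine Finset.sum_congr rfl fun k _ => ?_
      rw [show t + 1 - 1 - (k + 1) = t - 1 - k by omega]
      ring
    · simp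

theorem applyMLayers_append {d : ℕ} (ls ls' : List (MRecLayer d)) (u : ℕ → Fin d → ℝ) :
    applyMLayers (ls ++ ls') u = applyMLayers ls' (applyMLayers ls u) :=
  List.foldl_append

theorem applyMLayers_replicate_id {d : ℕ} (n : ℕ) (u : ℕ → Fin d → ℝ) :
    applyMLayers (List.replicate n (MRecLayer.pointwise 1 0 ∅)) u = u := by
  induction n with
  | zero => rfl
  | succ n ih =>
    have h : (MRecLayer.pointwise (1 : Matrix (Fin d) (Fin d) ℝ) 0 ∅).out u = u := by
      funext t
      rw [MRecLayer.pointwise_out, one_mulVec, add_zero]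
      funext i
      simp [actI]
    rw [List.replicate_succ]
    change applyMLayers _ ((MRecLayer.pointwise _ _ _).out u) = u
    rw [h, ih]

theorem selectMatrix_mulVec {m n : ℕ} (e : Fin m → Fin n) (v : Fin n → ℝ) :
    selectMatrix e *ᵥ v = v ∘ e := by
  funext i
  simp [selectMatrix, mulVec, dotProduct, Matrix.one_apply]

theorem selectMatrix_mulVec_transpose {m n : ℕ} {e : Fin m → Fin n}
    (he : Function.Injective e) (z : Fin m → ℝ) :
    selectMatrix e *ᵥ ((selectMatrix e)ᵀ *ᵥ z) = z := by
  rw [selectMatrix_mulVec]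
  funext i
  simp [selectMatrix, mulVec, dotProduct, Matrix.one_apply, he.eq_iff]

/-- The affine map `z ↦ A (C z) + b`, written on the coordinates listed by an injective `e`. -/
theorem select_affine {m n k : ℕ} {e : Fin m → Fin n} (he : Function.Injective e)
    (A : Matrix (Fin m) (Fin k) ℝ) (C : Matrix (Fin k) (Fin n) ℝ) (b : Fin m → ℝ)
    (v : Fin n → ℝ) (i : Fin m) :
    (((selectMatrix e)ᵀ * (A * C)) *ᵥ v + (selectMatrix e)ᵀ *ᵥ b) (e i) =
      (A *ᵥ (C *ᵥ v)) i + b i := by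
  have h := selectMatrix_mulVec_transpose he (A *ᵥ (C *ᵥ v) + b)
  rw [selectMatrix_mulVec] at h
  simpa [mulVec_add, mulVec_mulVec] using congrFun h i

/-- The first `l` hidden layers of a feedforward network, run on a linear image of the input,
are realized position-wise by `l` modified recurrent layers followed by a linear map. -/
theorem exists_layers_fnnSeq {D : ℕ} (ds : ℕ) (dims : ℕ → ℕ)
    (A : ∀ l : ℕ, Matrix (Fin (dims (l + 1))) (Fin (dims l)) ℝ)
    (c : ∀ l : ℕ, Fin (dims (l + 1)) → ℝ) (B : Matrix (Fin (dims 0)) (Fin D) ℝ)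
    (l : ℕ) (hdims : ∀ k ≤ l, dims k ≤ D) :
    ∃ (ls : List (MRecLayer D)) (C : Matrix (Fin (dims l)) (Fin D) ℝ),
      ls.length = l ∧ (∀ r ∈ ls, r.toRecLayer.BlockDiag ds) ∧
      ∀ u t, C *ᵥ applyMLayers ls u t = fnnSeq dims A c (B *ᵥ u t) l := by
  induction l with
  | zero => exact ⟨[], B, rfl, by simp, fun _ _ => rfl⟩
  | succ l ih =>
    obtain ⟨ls, C, hlen, hbd, h⟩ := ih fun k hk => hdims k (by omega)
    have hle := hdims (l + 1) le_rfl
    let S := selectMatrix (Fin.castLE hle)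
    refine ⟨ls ++ [MRecLayer.pointwise (Sᵀ * (A l * C)) (Sᵀ *ᵥ c l) Finset.univ], S,
      by simp [hlen], ?_, ?_⟩
    · intro r hr
      rcases List.mem_append.1 hr with hr | hr
      · exact hbd r hr
      · rw [List.mem_singleton.1 hr]
        exact MRecLayer.pointwise_blockDiag _ _ _ _
    · intro u t
      rw [applyMLayers_append]
      change S *ᵥ (MRecLayer.pointwise _ _ _).out _ t = _
      rw [MRecLayer.pointwise_out, selectMatrix_mulVec]
      funext i
      simp only [Function.comp_apply, actI, Finset.mem_univ, if_true, fnnSeq]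
      rw [select_affine (Fin.castLE_injective hle), h]

/-- One linear recurrent layer with diagonal recurrence stores the whole input history in a
linearly decodable way: the first `t0` inputs are recovered at position `t0 - 1`. -/
theorem exists_diagonal_encoding {din D T t0 : ℕ} (ht0 : 1 ≤ t0) (ht0T : t0 ≤ T)
    (hD : din * t0 ≤ D) :
    ∃ (P : Matrix (Fin D) (Fin din) ℝ) (lam : Fin D → ℝ)
      (B : Matrix (Fin (din * t0)) (Fin D) ℝ),
      ∀ X : Fin T → Fin din → ℝ,
        B *ᵥ (MRecLayer.diagonal lam).out (fun s => P *ᵥ extendInput X s) (t0 - 1) =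
          vecCols t0 ht0T X := by
  let e : Fin t0 → Fin din → Fin D := fun k j => ⟨din * k + j, by
    have h : din * k + din ≤ din * t0 := by
      rw [← Nat.mul_succ]
      exact Nat.mul_le_mul_left _ k.isLt
    have := j.isLt
    omega⟩
  let V : Matrix (Fin t0) (Fin t0) ℝ := vandermonde fun k => ((k : ℕ) : ℝ)
  have hV : IsUnit V.det := by
    refine isUnit_iff_ne_zero.2 (det_vandermonde_ne_zero_iff.2 fun a b hab => ?_)
    exact Fin.ext (Nat.cast_injective hab)
  let P : Matrix (Fin D) (Fin din) ℝ := fun i j => if (i : ℕ) % din = j then 1 else 0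
  let lam : Fin D → ℝ := fun i => ((i : ℕ) / din : ℕ)
  have row : ∀ q : Fin (din * t0), ∃ r : Fin D → ℝ, ∀ X : Fin T → Fin din → ℝ,
      r ⬝ᵥ (MRecLayer.diagonal lam).out (fun s => P *ᵥ extendInput X s) (t0 - 1) =
        vecCols t0 ht0T X q := by
    intro q
    have hdin : 0 < din := Nat.pos_of_ne_zero fun h => by
      have := q.isLt
      simp [h] at this
    let j : Fin din := ⟨q % din, Nat.mod_lt _ hdin⟩
    let s : Fin t0 := ⟨q / din, Nat.div_lt_of_lt_mul q.isLt⟩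
    refine ⟨fun i => ∑ k, V⁻¹ s.rev k * if e k j = i then 1 else 0, fun X => ?_⟩
    have hstate : ∀ k : Fin t0,
        (MRecLayer.diagonal lam).out (fun s => P *ᵥ extendInput X s) (t0 - 1) (e k j) =
          (V *ᵥ fun b : Fin t0 => X ⟨b.rev, b.rev.isLt.trans_le ht0T⟩ j) k := by
      intro k
      have hmod : (e k j : ℕ) % din = j := by
        simp [e, Nat.mod_eq_of_lt j.isLt]
      have hdiv : (e k j : ℕ) / din = k := by
        simp [e, Nat.mul_add_div hdin, Nat.div_eq_of_lt j.isLt]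
      rw [MRecLayer.out, MRecLayer.diagonal_state, Nat.sub_add_cancel ht0,
        Finset.sum_range]
      refine Finset.sum_congr rfl fun b _ => ?_
      have hb : t0 - 1 - (b : ℕ) = (b.rev : ℕ) := by
        rw [Fin.val_rev]
        omega
      have hP : ∀ z : Fin din → ℝ, (P *ᵥ z) (e k j) = z j := by
        intro z
        simp [P, mulVec, dotProduct, hmod, Fin.val_inj]
      rw [hP, hb]
      simp only [lam, hdiv, V, vandermonde_apply]
      rw [extendInput, dif_pos (b.rev.isLt.trans_le ht0T)]
    have hsum : ∀ h : Fin D → ℝ,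
        (fun i => ∑ k, V⁻¹ s.rev k * if e k j = i then (1 : ℝ) else 0) ⬝ᵥ h =
          (V⁻¹ *ᵥ fun k => h (e k j)) s.rev := by
      intro h
      simp only [dotProduct, mulVec, Finset.sum_mul]
      rw [Finset.sum_comm]
      simp
    rw [hsum, funext hstate, mulVec_mulVec, nonsing_inv_mul _ hV, one_mulVec]
    simp only [Fin.rev_rev]
    rfl
  choose B hB using row
  exact ⟨P, lam, B, fun X => funext fun q => hB q X⟩

/-- **FNNs can be represented by modified deep ParaRNNs.** Let `t0 ∈ {1,…,T}` and let `ds`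
be an even positive integer dividing `(din + 1)d`. For any ReLU feedforward network
`Ñ ∈ FNN_{din·t0, dout}(d, L)` there is a modified deep ParaRNN `N̄` with input dimension
`din`, output dimension `dout`, width `(din + 1)d`, block size `ds`, and depth `T + L − 1`
such that `Ñ(x_1,…,x_{t0}) = N̄(X)[t0]` for every `X ∈ ℝ^{din×T}`. -/
theorem stmt18 (din dout d ds T L t0 : ℕ)
    (hds0 : 0 < ds) (hds : Even ds) (hdvd : ds ∣ (din + 1) * d)
    (ht0 : 1 ≤ t0) (ht0T : t0 ≤ T) (hL : 1 ≤ L)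
    (g : (Fin (din * t0) → ℝ) → Fin dout → ℝ)
    (hg : MemFNN (din * t0) dout d L g) :
    ∃ mnet : MParaNet din dout ((din + 1) * d) ds (T + L - 1),
      ∀ (X : Fin T → Fin din → ℝ) (i : Fin dout),
        g (vecCols t0 ht0T X) i = mnet.forward (extendInput X) (t0 - 1) i := by
  obtain ⟨dims, h0, hdL, A, c, hle, hgx⟩ := hg
  obtain ⟨l, rfl⟩ : ∃ l, L = l + 1 := ⟨L - 1, by omega⟩
  set D := (din + 1) * d with hDdef
  have hdD : d ≤ D := Nat.le_mul_of_pos_left _ (Nat.succ_pos _)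
  have hdimsD : ∀ k ≤ l + 1, dims k ≤ D := fun k hk => (hle k hk).trans hdD
  obtain ⟨P, lam, B, hB⟩ := exists_diagonal_encoding (din := din) (D := D) ht0 ht0T
    (h0 ▸ hdimsD 0 (by omega))
  obtain ⟨ls, C, hlen, hbd, hC⟩ := exists_layers_fnnSeq ds dims A c
    (B.submatrix (Fin.cast h0) id) l fun k hk => hdimsD k (by omega)
  let layers : List (MRecLayer D) := MRecLayer.diagonal lam ::
    (List.replicate (T - 1) (MRecLayer.pointwise 1 0 ∅) ++ ls)
  have hlayers : ∀ r ∈ layers, r.toRecLayer.BlockDiag ds := by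
    intro r hr
    rcases List.mem_cons.1 hr with rfl | hr
    · exact MRecLayer.diagonal_blockDiag _ _
    rcases List.mem_append.1 hr with hr | hr
    · rw [List.eq_of_mem_replicate hr]
      exact MRecLayer.pointwise_blockDiag _ _ _ _
    · exact hbd r hr
  have hlength : layers.length = T + (l + 1) - 1 := by
    simp only [layers, List.length_cons, List.length_append, List.length_replicate, hlen]
    omega
  obtain ⟨f, hf⟩ : ∃ f : Fin (T + (l + 1) - 1) → MRecLayer D, List.ofFn f = layers := by
    rw [← hlength]
    exact ⟨layers.get, List.ofFn_get layers⟩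
  have hDL := hdimsD (l + 1) le_rfl
  let S := selectMatrix (Fin.castLE hDL)
  refine ⟨{
    P := P
    layer := f
    blockdiag := fun k => hlayers _ (hf ▸ List.mem_ofFn.2 ⟨k, rfl⟩)
    Wf := Sᵀ * (A l * C)
    bf := Sᵀ *ᵥ c l
    actF := ∅
    Q := S.submatrix (Fin.cast hdL.symm) id }, fun X i => ?_⟩
  have happ : applyMLayers layers (fun s => P *ᵥ extendInput X s) =
      applyMLayers ls ((MRecLayer.diagonal lam).out fun s => P *ᵥ extendInput X s) := by
    change applyMLayers (_ ++ ls) ((MRecLayer.diagonal lam).out _) = _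
    rw [applyMLayers_append, applyMLayers_replicate_id]
  have hvec : (B.submatrix (Fin.cast h0) id) *ᵥ
      (MRecLayer.diagonal lam).out (fun s => P *ᵥ extendInput X s) (t0 - 1) =
      fun j => vecCols t0 ht0T X (Fin.cast h0 j) :=
    funext fun j => congrFun (hB X) (Fin.cast h0 j)
  rw [hgx]
  simp only [MParaNet.forward, fnnOut, hf, happ]
  rw [← hvec, ← hC]
  change _ = (S *ᵥ _) (Fin.cast hdL.symm i)
  rw [selectMatrix_mulVec]
  simp only [Function.comp_apply, actI, Finset.notMem_empty, if_false]
  exact (select_affine (Fin.castLE_injective hDL) (A l) C (c l) _ _).symm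
end

section
/- For every positive integer T, the T×T real matrix Λ_T whose (i, j) entry equals the binomial coefficient C(2T − i − j, T − i) for 1 ≤ i, j ≤ T is invertible. -/
open Matrix

/-- The symmetric form of Vandermonde's identity. -/
theorem choose_add_eq_sum_choose_mul_choose {a n : ℕ} (b : ℕ) (ha : a < n) :
    (a + b).choose a = ∑ k ∈ Finset.range n, a.choose k * b.choose k := by
  rw [add_comm, Nat.add_choose_eq, Finset.Nat.sum_antidiagonal_eq_sum_range_succ_mk]
  refine (Finset.sum_congr rfl fun k hk => ?_).trans
    (Finset.sum_subset (Finset.range_mono (Nat.succ_le_of_lt ha)) fun k _ hk => ?_)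
  · rw [Nat.choose_symm (Finset.mem_range_succ_iff.mp hk), mul_comm]
  · rw [Nat.choose_eq_zero_of_lt (by simpa [Nat.lt_succ_iff] using hk), zero_mul]

/-- The lower triangular matrix of binomial coefficients. -/
def lowerPascal (n : ℕ) : Matrix (Fin n) (Fin n) ℝ :=
  Matrix.of fun i j => ((i : ℕ).choose j : ℝ)

theorem det_lowerPascal (n : ℕ) : (lowerPascal n).det = 1 := by
  rw [Matrix.det_of_isLowerTriangular]
  · simp [lowerPascal]
  · intro i j hij
    simp only [lowerPascal, Matrix.of_apply, Nat.cast_eq_zero]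
    exact Nat.choose_eq_zero_of_lt hij

theorem lowerPascal_mul_transpose_apply (n : ℕ) (i j : Fin n) :
    (lowerPascal n * (lowerPascal n)ᵀ) i j = (((i : ℕ) + j).choose i : ℝ) := by
  rw [choose_add_eq_sum_choose_mul_choose (j : ℕ) i.isLt, Finset.sum_range]
  simp [Matrix.mul_apply, lowerPascal]

/-- For every positive integer `T`, the `T × T` real matrix `Λ_T` whose `(i, j)` entry
(1-indexed) is the binomial coefficient `C(2T − i − j, T − i)` is invertible. -/
theorem stmt19 (T : ℕ) (hT : 0 < T) :
    IsUnit (Matrix.of fun i j : Fin T =>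
      ((Nat.choose (2 * T - ((i : ℕ) + 1) - ((j : ℕ) + 1)) (T - ((i : ℕ) + 1))) : ℝ)).det := by
  have h : (Matrix.of fun i j : Fin T =>
      ((Nat.choose (2 * T - ((i : ℕ) + 1) - ((j : ℕ) + 1)) (T - ((i : ℕ) + 1))) : ℝ)) =
      (lowerPascal T * (lowerPascal T)ᵀ).submatrix Fin.revPerm Fin.revPerm := by
    ext i j
    rw [Matrix.submatrix_apply, lowerPascal_mul_transpose_apply, Matrix.of_apply]
    simp only [Fin.revPerm_apply, Fin.val_rev]
    congr 2
    omega
  rw [h, Matrix.det_submatrix_equiv_self, Matrix.det_mul, Matrix.det_transpose, det_lowerPascal]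
  simp
end
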